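/- arXiv:1112.2275 — 9 statements merged into one kernel-verified Lean document; each statement's English description precedes it below -/
import Mathlib

section
/- Let A and B be finite sets and let E ⊆ A × B be an edge relation. Then the number of independent sets of the bipartite graph (A, B, E), i.e., the number of pairs (X, Y) with X ⊆ A, Y ⊆ B such that no a ∈ X and b ∈ Y satisfy (a,b) ∈ E, is congruent modulo 2 to the number of subsets X ⊆ A with N(X) = B. -/
open Classical in
/-- The independent sets with first component `X` are the pairs `(X, Y)` with `Y` a set of
non-neighbors of `X`. -/
theorem card_independent_eq_sum {A B : Type*} [Fintype A] [Fintype B] (E : A → B → Prop) :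
    Nat.card {p : Finset A × Finset B // ∀ a ∈ p.1, ∀ b ∈ p.2, ¬ E a b} =
      ∑ X : Finset A, 2 ^ (Finset.univ.filter fun b : B => ∀ a ∈ X, ¬ E a b).card := by
  rw [Nat.card_eq_fintype_card, Fintype.card_subtype, Finset.card_filter,
    Fintype.sum_prod_type]
  refine Finset.sum_congr rfl fun X _ => ?_
  rw [← Finset.card_filter, ← Finset.card_powerset]
  congr 1
  ext Y
  simp only [Finset.mem_filter, Finset.mem_univ, true_and, Finset.mem_powerset,
    Finset.subset_iff]
  exact ⟨fun h b hb a ha => h a ha b hb, fun h a ha b hb => h hb a ha⟩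

/-- The number of independent sets (X, Y) of the bipartite graph
(A, B, E) is congruent mod 2 to the number of subsets X ⊆ A with N(X) = B. -/
theorem stmt_0 {A B : Type*} [Fintype A] [Fintype B] (E : A → B → Prop) :
    Nat.card {p : Finset A × Finset B // ∀ a ∈ p.1, ∀ b ∈ p.2, ¬ E a b}
      ≡ Nat.card {X : Finset A // ∀ b : B, ∃ a ∈ X, E a b} [MOD 2] := by
  classical
  rw [card_independent_eq_sum, Nat.card_eq_fintype_card, Fintype.card_subtype,
    Finset.card_filter, ← ZMod.natCast_eq_natCast_iff]
  push_cast
  refine Finset.sum_congr rfl fun X _ => ?_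
  rw [show (2 : ZMod 2) = 0 from rfl, zero_pow_eq]
  refine if_congr ?_ rfl rfl
  simp [Finset.filter_eq_empty_iff]
end

section
/- Let A and B be finite sets and let E ⊆ A × B be an edge relation. Then the number of subsets X ⊆ A with N(X) = B is congruent modulo 2 to the number of subsets Y ⊆ B with N(Y) = A. -/
/-- The number of finsets all of whose elements satisfy `p` is odd exactly when no element
satisfies `p`. -/
theorem sum_ite_forall_mem_zmod_two {B : Type*} [Fintype B] (p : B → Prop)
    [DecidablePred fun Y : Finset B => ∀ b ∈ Y, p b] [Decidable (∀ b, ¬ p b)] :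
    (∑ Y : Finset B, if ∀ b ∈ Y, p b then (1 : ZMod 2) else 0) = if ∀ b, ¬ p b then 1 else 0 := by
  classical
  have h : (Finset.univ.filter fun Y : Finset B => ∀ b ∈ Y, p b)
      = (Finset.univ.filter p).powerset := by
    ext Y
    simp [Finset.subset_iff]
  have h2 : (2 : ZMod 2) = 0 := rfl
  rw [Finset.sum_boole, h, Finset.card_powerset, Nat.cast_pow, Nat.cast_ofNat, h2, zero_pow_eq]
  simp [Finset.filter_eq_empty_iff]

open Classical in
/-- Modulo 2, the dominating subsets of `A` are counted by the pairs of subsets of `A` and `B`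
with no edge between them. -/
theorem card_dominating_eq_sum_zmod_two {A B : Type*} [Fintype A] [Fintype B]
    (E : A → B → Prop) :
    (Nat.card {X : Finset A // ∀ b : B, ∃ a ∈ X, E a b} : ZMod 2)
      = ∑ X : Finset A, ∑ Y : Finset B, if ∀ b ∈ Y, ∀ a ∈ X, ¬ E a b then 1 else 0 := by
  rw [Finset.sum_congr rfl fun X _ => sum_ite_forall_mem_zmod_two fun b => ∀ a ∈ X, ¬ E a b,
    Finset.sum_boole, Nat.card_eq_fintype_card, Fintype.card_subtype]
  simp

/-- The number of subsets X ⊆ A with N(X) = B is congruent mod 2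
to the number of subsets Y ⊆ B with N(Y) = A. -/
theorem stmt_1 {A B : Type*} [Fintype A] [Fintype B] (E : A → B → Prop) :
    Nat.card {X : Finset A // ∀ b : B, ∃ a ∈ X, E a b}
      ≡ Nat.card {Y : Finset B // ∀ a : A, ∃ b ∈ Y, E a b} [MOD 2] := by
  rw [← ZMod.natCast_eq_natCast_iff, card_dominating_eq_sum_zmod_two,
    card_dominating_eq_sum_zmod_two fun b a => E a b, Finset.sum_comm]
  refine Finset.sum_congr rfl fun Y _ => Finset.sum_congr rfl fun X _ => ?_
  congr 1
  exact propext ⟨fun h a ha b hb => h b hb a ha, fun h b hb a ha => h a ha b hb⟩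
end

section
/- Let F be a finite family of subsets of a finite set U. Then the number of hitting sets of F is congruent modulo 2 to the number of set covers of F. -/
theorem Finset.cast_card_powerset_zmod_two {α : Type*} [DecidableEq α]
    (s : Finset α) :
    ((s.powerset.card : ℕ) : ZMod 2) = if s = ∅ then 1 else 0 := by
  have two_eq_zero : (2 : ZMod 2) = 0 := rfl
  split_ifs with h
  · simp [h]
  · simp [Finset.card_powerset, two_eq_zero, zero_pow, h]

/-- The number of hitting sets of F is congruent mod 2 to the
number of set covers of F. -/
theorem stmt_2 {U : Type*} [Fintype U] [DecidableEq U] (F : Finset (Finset U)) :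
    Nat.card {H : Finset U // ∀ S ∈ F, (H ∩ S).Nonempty}
      ≡ Nat.card {C : Finset (Finset U) // C ⊆ F ∧ ∀ u : U, ∃ S ∈ C, u ∈ S} [MOD 2] := by
  -- Double count the pairs `(H, C)` with `C ⊆ F` and every member of `C` disjoint from `H`.
  let r : Finset U → Finset (Finset U) → Prop := fun H C => ∀ S ∈ C, Disjoint H S
  have double_count := congrArg (Nat.cast : ℕ → ZMod 2)
    (Finset.sum_card_bipartiteAbove_eq_sum_card_bipartiteBelow
      (s := (Finset.univ : Finset (Finset U))) (t := F.powerset) r)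
  have above (H : Finset U) : F.powerset.bipartiteAbove r H =
      (F.filter fun S => Disjoint H S).powerset := by
    ext C
    simp only [Finset.mem_bipartiteAbove, Finset.mem_powerset, Finset.subset_iff,
      Finset.mem_filter, r]
    exact forall₂_and.symm
  have below (C : Finset (Finset U)) : (Finset.univ : Finset (Finset U)).bipartiteBelow r C =
      (Finset.univ.filter fun u => ∀ S ∈ C, u ∉ S).powerset := by
    ext H
    simp only [Finset.mem_bipartiteBelow, Finset.mem_univ, true_and, Finset.mem_powerset,
      Finset.subset_iff, Finset.mem_filter, r, Finset.disjoint_left]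
    tauto
  rw [← ZMod.natCast_eq_natCast_iff, Nat.card_eq_fintype_card, Nat.card_eq_fintype_card,
    Fintype.card_subtype, Fintype.card_subtype]
  simp only [above, below, Nat.cast_sum, Finset.cast_card_powerset_zmod_two,
    Finset.sum_boole] at double_count
  convert double_count using 3
  · ext H
    simp [Finset.filter_eq_empty_iff, Finset.not_disjoint_iff_nonempty_inter]
  · ext C
    simp [Finset.filter_eq_empty_iff]
end

section
/- Let q be a power of two and let n be a natural number divisible by q. Then the number of unordered partitions of an n-element set into blocks each of size exactly q is odd. -/
theorem odd_choose_two_pow_sub_one (l m : ℕ) :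
    Odd (Nat.choose (m * 2 ^ l + (2 ^ l - 1)) (2 ^ l - 1)) := by
  induction l with
  | zero => simp
  | succ l ih =>
    have hpos : 0 < 2 ^ l := by positivity
    obtain ⟨r, hr⟩ : ∃ r, 2 ^ l = r + 1 := ⟨2 ^ l - 1, by lia⟩
    have h1 : 2 ^ (l + 1) - 1 = 2 * (2 ^ l - 1) + 1 := by rw [pow_succ]; lia
    have h2 : m * 2 ^ (l + 1) + (2 ^ (l + 1) - 1) = 2 * (m * 2 ^ l + (2 ^ l - 1)) + 1 := by
      rw [h1, pow_succ]; ring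
    rw [h2, h1]
    have key := Choose.choose_modEq_choose_mod_mul_choose_div_nat (p := 2)
      (n := 2 * (m * 2 ^ l + (2 ^ l - 1)) + 1) (k := 2 * (2 ^ l - 1) + 1)
    have hmod (x : ℕ) : (2 * x + 1) % 2 = 1 := by lia
    have hdiv (x : ℕ) : (2 * x + 1) / 2 = x := by lia
    rw [hmod, hmod, hdiv, hdiv, Nat.choose_self, one_mul] at key
    rw [Nat.odd_iff] at ih ⊢
    exact Eq.trans key ih

/-- `P` is a partition of the finite set `S` into blocks of size `q`. -/
def IsUniformPartition {A : Type*} (q : ℕ) (S : Finset A) (P : Finset (Finset A)) : Prop :=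
  (∀ X ∈ P, X.card = q) ∧ (∀ X ∈ P, ∀ Y ∈ P, X ≠ Y → Disjoint X Y) ∧
    ∀ a, a ∈ S ↔ ∃ X ∈ P, a ∈ X

namespace IsUniformPartition

variable {A : Type*} {q : ℕ} {S X : Finset A} {P : Finset (Finset A)}

theorem subset (hP : IsUniformPartition q S P) (hX : X ∈ P) : X ⊆ S :=
  fun a ha => (hP.2.2 a).2 ⟨X, hX, ha⟩

variable [DecidableEq A]

theorem insert_block (hX : X.card = q) (hXS : X ⊆ S) (hP : IsUniformPartition q (S \ X) P) :
    IsUniformPartition q S (insert X P) := by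
  have hd : ∀ Y ∈ P, Disjoint Y X := fun Y hY =>
    Finset.disjoint_of_subset_left (hP.subset hY) Finset.sdiff_disjoint
  refine ⟨?_, ?_, fun a => ?_⟩
  · simpa [hX] using hP.1
  · intro Y hY Z hZ hne
    rcases Finset.mem_insert.1 hY with rfl | hYP <;> rcases Finset.mem_insert.1 hZ with rfl | hZP
    · exact absurd rfl hne
    · exact (hd Z hZP).symm
    · exact hd Y hYP
    · exact hP.2.1 Y hYP Z hZP hne
  · have h := hP.2.2 a
    have h' := @hXS a
    simp only [Finset.mem_sdiff, Finset.exists_mem_insert] at h ⊢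
    rw [← h]
    tauto

theorem erase_block (hP : IsUniformPartition q S P) (hX : X ∈ P) :
    IsUniformPartition q (S \ X) (P.erase X) := by
  refine ⟨fun Y hY => hP.1 Y (Finset.mem_of_mem_erase hY), fun Y hY Z hZ => hP.2.1 Y
    (Finset.mem_of_mem_erase hY) Z (Finset.mem_of_mem_erase hZ), fun a => ?_⟩
  rw [Finset.mem_sdiff, hP.2.2 a]
  constructor
  · rintro ⟨⟨Y, hY, ha⟩, hn⟩
    exact ⟨Y, Finset.mem_erase.2 ⟨fun h => hn (h ▸ ha), hY⟩, ha⟩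
  · rintro ⟨Y, hY, ha⟩
    obtain ⟨hne, hY⟩ := Finset.mem_erase.1 hY
    exact ⟨⟨Y, hY, ha⟩, Finset.disjoint_left.1 (hP.2.1 Y hY X hX hne) ha⟩

end IsUniformPartition

open Classical in
/-- The finite set of all partitions of `S` into blocks of size `q`. -/
noncomputable def uniformPartitions {A : Type*} (q : ℕ) (S : Finset A) :
    Finset (Finset (Finset A)) :=
  S.powerset.powerset.filter (IsUniformPartition q S)

section uniformPartitions

variable {A : Type*} {q : ℕ} {S : Finset A}

theorem mem_uniformPartitions {P : Finset (Finset A)} :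
    P ∈ uniformPartitions q S ↔ IsUniformPartition q S P := by
  simp only [uniformPartitions, Finset.mem_filter, Finset.mem_powerset, and_iff_right_iff_imp]
  exact fun h X hX => Finset.mem_powerset.2 (h.subset hX)

theorem uniformPartitions_empty (hq : 0 < q) :
    uniformPartitions q (∅ : Finset A) = {∅} := by
  ext P
  rw [mem_uniformPartitions, Finset.mem_singleton]
  constructor
  · intro h
    refine Finset.eq_empty_of_forall_notMem fun X hX => ?_
    have h1 := h.1 X hX
    rw [Finset.subset_empty.1 (h.subset hX), Finset.card_empty] at h1
    lia
  · rintro rfl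
    simp [IsUniformPartition]

variable [DecidableEq A]

theorem card_uniformPartitions (hq : 0 < q) {a : A} (ha : a ∈ S) :
    (uniformPartitions q S).card =
      ∑ T ∈ (S.erase a).powersetCard (q - 1), (uniformPartitions q (S \ insert a T)).card := by
  have hT : ∀ T ∈ (S.erase a).powersetCard (q - 1),
      a ∉ T ∧ insert a T ⊆ S ∧ (insert a T).card = q := by
    intro T hT
    obtain ⟨hTS, hc⟩ := Finset.mem_powersetCard.1 hT
    have haT : a ∉ T := fun h => Finset.notMem_erase a S (hTS h)
    refine ⟨haT, Finset.insert_subset ha (hTS.trans (Finset.erase_subset _ _)), ?_⟩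
    rw [Finset.card_insert_of_notMem haT]
    lia
  have hnot : ∀ T, ∀ P ∈ uniformPartitions q (S \ insert a T), insert a T ∉ P := by
    intro T P hP h
    have := (mem_uniformPartitions.1 hP).subset h (Finset.mem_insert_self a T)
    simp at this
  have hunion : uniformPartitions q S = ((S.erase a).powersetCard (q - 1)).biUnion
      fun T => (uniformPartitions q (S \ insert a T)).image (insert (insert a T)) := by
    ext P
    simp only [Finset.mem_biUnion, Finset.mem_image]
    constructor
    · intro hP
      have hP' := mem_uniformPartitions.1 hP
      obtain ⟨X, hX, haX⟩ := (hP'.2.2 a).1 ha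
      refine ⟨X.erase a, Finset.mem_powersetCard.2
        ⟨Finset.erase_subset_erase a (hP'.subset hX), ?_⟩, P.erase X, ?_, ?_⟩
      · rw [Finset.card_erase_of_mem haX, hP'.1 X hX]
      · rw [Finset.insert_erase haX]
        exact mem_uniformPartitions.2 (hP'.erase_block hX)
      · rw [Finset.insert_erase haX, Finset.insert_erase hX]
    · rintro ⟨T, hmem, Q, hQ, rfl⟩
      obtain ⟨-, hs, hc⟩ := hT T hmem
      exact mem_uniformPartitions.2 ((mem_uniformPartitions.1 hQ).insert_block hc hs)
  rw [hunion, Finset.card_biUnion]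
  · refine Finset.sum_congr rfl fun T _ => Finset.card_image_of_injOn fun P hP Q hQ h => ?_
    have h' := congrArg (fun R => R.erase (insert a T)) h
    simpa [Finset.erase_insert (hnot T P hP), Finset.erase_insert (hnot T Q hQ)] using h'
  · intro T hmem U hmem' hne
    refine Finset.disjoint_left.2 fun R hR hR' => hne ?_
    obtain ⟨P, hP, rfl⟩ := Finset.mem_image.1 hR
    obtain ⟨Q, hQ, h⟩ := Finset.mem_image.1 hR'
    obtain ⟨haT, hs, hc⟩ := hT T hmem
    obtain ⟨haU, -, -⟩ := hT U hmem'
    have hpart := (mem_uniformPartitions.1 hP).insert_block hc hs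
    have hU : insert a U ∈ insert (insert a T) P := h ▸ Finset.mem_insert_self _ _
    have heq : insert a T = insert a U := by
      by_contra hcon
      exact Finset.disjoint_left.1
        (hpart.2.1 _ (Finset.mem_insert_self _ _) _ hU hcon)
        (Finset.mem_insert_self a T) (Finset.mem_insert_self a U)
    rw [← Finset.erase_insert haT, heq, Finset.erase_insert haU]

theorem odd_card_uniformPartitions (l m : ℕ) (S : Finset A) (hS : S.card = m * 2 ^ l) :
    Odd (uniformPartitions (2 ^ l) S).card := by
  have hpos : 0 < 2 ^ l := by positivity
  induction m generalizing S with
  | zero =>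
    obtain rfl : S = ∅ := by simpa using hS
    simp [uniformPartitions_empty hpos]
  | succ m ih =>
    rw [Nat.succ_mul] at hS
    obtain ⟨a, ha⟩ : S.Nonempty := Finset.card_pos.1 (by lia)
    rw [card_uniformPartitions hpos ha, Finset.odd_sum_iff_odd_card_odd,
      Finset.filter_true_of_mem, Finset.card_powersetCard, Finset.card_erase_of_mem ha, hS,
      Nat.add_sub_assoc hpos]
    · exact odd_choose_two_pow_sub_one l m
    · intro T hT
      obtain ⟨hTS, hc⟩ := Finset.mem_powersetCard.1 hT
      have haT : a ∉ T := fun h => Finset.notMem_erase a S (hTS h)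
      apply ih
      rw [Finset.card_sdiff_of_subset
        (Finset.insert_subset ha (hTS.trans (Finset.erase_subset _ _))),
        Finset.card_insert_of_notMem haT, hS, hc]
      lia

end uniformPartitions

/-- If q is a power of two and q divides n = |A|, then the number of
unordered partitions of A into blocks of size exactly q is odd. -/
theorem stmt_6 {A : Type*} [Fintype A] [DecidableEq A] (n q ℓ : ℕ) (hq : q = 2 ^ ℓ)
    (hcard : Fintype.card A = n) (hdvd : q ∣ n) :
    Odd (Nat.card {P : Finset (Finset A) // (∀ X ∈ P, X.card = q) ∧
        (∀ X ∈ P, ∀ Y ∈ P, X ≠ Y → Disjoint X Y) ∧ (∀ a : A, ∃ X ∈ P, a ∈ X)}) := by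
  subst hq
  obtain ⟨m, hm⟩ := hdvd
  have hodd := odd_card_uniformPartitions ℓ m (Finset.univ : Finset A)
    (by rw [Finset.card_univ, hcard, hm, mul_comm])
  convert hodd using 1
  exact Nat.subtype_card _ fun P => by simp [mem_uniformPartitions, IsUniformPartition]
end

section
/- Let F be a finite family of subsets of a finite set U, let q ≥ 1, and let t be a natural number with q dividing t and t ≤ |F|. Let F' = { ⋃_{S ∈ G} S : G ⊆ F, |G| = q } be the family of all unions of exactly q distinct sets from F. Then F has a subfamily of size at most t whose union is U if and only if F' has a subfamily of size at most t/q whose union is U. -/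
/-- A finite set with `k * q` elements is covered by at most `k` of its `q`-element subsets. -/
theorem Finset.exists_powersetCard_cover {α : Type*} [DecidableEq α] (q k : ℕ) (D : Finset α)
    (hD : D.card = k * q) :
    ∃ P ⊆ D.powersetCard q, P.card ≤ k ∧ ∀ x ∈ D, ∃ G ∈ P, x ∈ G := by
  induction k generalizing D with
  | zero =>
    obtain rfl : D = ∅ := by simpa using hD
    exact ⟨∅, by simp⟩
  | succ k ih =>
    obtain ⟨G, hGD, hG⟩ := Finset.exists_subset_card_eq (s := D) (n := q) (by
      rw [hD, Nat.succ_mul]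
      exact Nat.le_add_left _ _)
    obtain ⟨P, hPD, hPk, hP⟩ := ih (D \ G) (by
      rw [Finset.card_sdiff_of_subset hGD, hD, hG, Nat.succ_mul, Nat.add_sub_cancel])
    refine ⟨insert G P, ?_, (Finset.card_insert_le _ _).trans (by omega), fun x hx => ?_⟩
    · rw [Finset.insert_subset_iff, Finset.mem_powersetCard]
      exact ⟨⟨hGD, hG⟩, hPD.trans (Finset.powersetCard_mono Finset.sdiff_subset)⟩
    · by_cases hxG : x ∈ G
      · exact ⟨G, Finset.mem_insert_self _ _, hxG⟩
      · obtain ⟨H, hH, hxH⟩ := hP x (Finset.mem_sdiff.2 ⟨hx, hxG⟩)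
        exact ⟨H, Finset.mem_insert_of_mem hH, hxH⟩

/-- For q ≥ 1 with q ∣ t and t ≤ |F|, letting F' be the family of all
unions of exactly q distinct sets from F, F has a set cover of size at most t iff
F' has a set cover of size at most t/q. -/
theorem stmt_10 {U : Type*} [Fintype U] [DecidableEq U] (F : Finset (Finset U))
    (q t : ℕ) (hq : 1 ≤ q) (hdvd : q ∣ t) (ht : t ≤ F.card) :
    (∃ C ⊆ F, C.card ≤ t ∧ ∀ u : U, ∃ S ∈ C, u ∈ S) ↔
      (∃ C ⊆ (F.powersetCard q).image (fun G => G.sup id),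
        C.card ≤ t / q ∧ ∀ u : U, ∃ S ∈ C, u ∈ S) := by
  constructor
  · rintro ⟨C, hCF, hCt, hC⟩
    obtain ⟨D, hCD, hDF, hD⟩ := Finset.exists_subsuperset_card_eq hCF hCt ht
    obtain ⟨P, hPD, hPk, hP⟩ :=
      Finset.exists_powersetCard_cover q (t / q) D (by rw [hD, Nat.div_mul_cancel hdvd])
    refine ⟨P.image fun G => G.sup id,
      Finset.image_subset_image (hPD.trans (Finset.powersetCard_mono hDF)),
      Finset.card_image_le.trans hPk, fun u => ?_⟩
    obtain ⟨S, hS, hu⟩ := hC u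
    obtain ⟨G, hG, hSG⟩ := hP S (hCD hS)
    exact ⟨G.sup id, Finset.mem_image_of_mem _ hG, Finset.mem_sup.2 ⟨S, hSG, hu⟩⟩
  · rintro ⟨C, hCF, hCt, hC⟩
    obtain ⟨P, hPF, hinj, rfl⟩ :=
      Finset.exists_subset_injOn_image_eq_of_surjOn
        (F.powersetCard q : Set (Finset (Finset U))) C fun S hS => by simpa using hCF hS
    rw [Finset.coe_subset] at hPF
    rw [Finset.card_image_of_injOn hinj] at hCt
    refine ⟨P.biUnion id, ?_, ?_, fun u => ?_⟩
    · exact Finset.biUnion_subset.2 fun G hG => (Finset.mem_powersetCard.1 (hPF hG)).1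
    · calc (P.biUnion id).card
          ≤ P.card * q := Finset.card_biUnion_le_card_mul _ _ _ fun G hG =>
            (Finset.mem_powersetCard.1 (hPF hG)).2.le
        _ ≤ t / q * q := Nat.mul_le_mul_right q hCt
        _ = t := Nat.div_mul_cancel hdvd
    · obtain ⟨S, hS, hu⟩ := hC u
      obtain ⟨G, hG, rfl⟩ := Finset.mem_image.1 hS
      obtain ⟨T, hT, huT⟩ := Finset.mem_sup.1 hu
      exact ⟨T, Finset.mem_biUnion.2 ⟨G, hG, hT⟩, huT⟩
end

section
/- Let U be a finite set partitioned into blocks U_1, ..., U_g, each of size p, let t_1, ..., t_g be natural numbers with 0 ≤ t_i ≤ p for each i, and let F be a finite family of subsets of U. Let R and B be two elements not in U, and let F' be the family over universe U ∪ {R, B} consisting of: the set {R, B}; the set X ∪ {R} for every index i with t_i < p and every (t_i + 1)-element subset X of U_i; and the set Y ∪ {B} for every Y ∈ F. Then F' has a set splitting if and only if F has a hitting set H ⊆ U with |H ∩ U_i| ≤ t_i for every i. -/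
/-- A finite set meets `A` in at most `k` points iff it contains no `(k + 1)`-subset of `A`. -/
theorem card_inter_le_iff_forall_powersetCard {U : Type*} [DecidableEq U] (H A : Finset U)
    (k : ℕ) :
    (H ∩ A).card ≤ k ↔ ∀ X ∈ A.powersetCard (k + 1), ∃ u ∈ X, u ∉ H := by
  constructor
  · intro h X hX
    obtain ⟨hXA, hXc⟩ := Finset.mem_powersetCard.mp hX
    by_contra! hXH
    have := Finset.card_le_card (Finset.subset_inter hXH hXA)
    omega
  · intro h
    by_contra! hk
    obtain ⟨X, hX, hXc⟩ := Finset.exists_subset_card_eq (Nat.succ_le_of_lt hk)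
    obtain ⟨u, huX, huH⟩ := h X (Finset.mem_powersetCard.mpr
      ⟨hX.trans Finset.inter_subset_right, hXc⟩)
    exact huH (Finset.mem_inter.mp (hX huX)).1

/-- `S` splits `X ∪ {b}` iff some point of `X` lies on the other side of `S` from `b`. -/
theorem splits_image_inl_union_iff {U : Type*} [DecidableEq U] (S : Finset (U ⊕ Bool))
    (X : Finset U) (b : Bool) :
    (((X.image Sum.inl ∪ {Sum.inr b}) ∩ S).Nonempty ∧
      ((X.image Sum.inl ∪ {Sum.inr b}) \ S).Nonempty) ↔
      ∃ u ∈ X, ¬ (Sum.inl u ∈ S ↔ Sum.inr b ∈ S) := by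
  by_cases hb : Sum.inr b ∈ S <;>
    simp [Finset.Nonempty, hb, or_and_right, exists_or]

/-- `S` splits `{R, B}` iff it contains exactly one of the two. -/
theorem splits_pair_iff {U : Type*} [DecidableEq U] (S : Finset (U ⊕ Bool)) :
    ((({Sum.inr true, Sum.inr false} : Finset (U ⊕ Bool)) ∩ S).Nonempty ∧
      (({Sum.inr true, Sum.inr false} : Finset (U ⊕ Bool)) \ S).Nonempty) ↔
      (Sum.inr false ∈ S ↔ Sum.inr true ∉ S) := by
  by_cases hb : Sum.inr true ∈ S <;> by_cases hc : Sum.inr false ∈ S <;>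
    simp [Finset.Nonempty, hb, hc, or_and_right, exists_or]


/-- Given a partition of U into blocks U_1, ..., U_g of size p,
thresholds t_i ≤ p, and a family F over U, the family F' over U ∪ {R, B}
(with R = Sum.inr true and B = Sum.inr false) consisting of {R,B}, the sets
X ∪ {R} for t_i < p and X a (t_i+1)-subset of U_i, and the sets Y ∪ {B} for Y ∈ F,
has a set splitting iff F has a hitting set H with |H ∩ U_i| ≤ t_i for all i. -/
theorem stmt_12 {U : Type*} [Fintype U] [DecidableEq U] (g p : ℕ)
    (blocks : Fin g → Finset U)
    (hdisj : ∀ i j : Fin g, i ≠ j → Disjoint (blocks i) (blocks j))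
    (hcover : ∀ u : U, ∃ i : Fin g, u ∈ blocks i)
    (hsize : ∀ i : Fin g, (blocks i).card = p)
    (t : Fin g → ℕ) (ht : ∀ i : Fin g, t i ≤ p)
    (F : Finset (Finset U)) :
    (∃ S : Finset (U ⊕ Bool),
        ∀ T ∈ ({({Sum.inr true, Sum.inr false} : Finset (U ⊕ Bool))} : Finset (Finset (U ⊕ Bool)))
            ∪ (Finset.univ : Finset (Fin g)).biUnion (fun i =>
                if t i < p then
                  ((blocks i).powersetCard (t i + 1)).image
                    (fun X => X.image Sum.inl ∪ {Sum.inr true})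
                else ∅)
            ∪ F.image (fun Y => Y.image Sum.inl ∪ {Sum.inr false}),
          (T ∩ S).Nonempty ∧ (T \ S).Nonempty) ↔
      (∃ H : Finset U, (∀ Y ∈ F, (H ∩ Y).Nonempty) ∧
        ∀ i : Fin g, (H ∩ blocks i).card ≤ t i) := by
  constructor
  · rintro ⟨S, hS⟩
    have hpair := (splits_pair_iff S).mp (hS _ (by simp))
    refine ⟨Finset.univ.filter fun u => (Sum.inl u ∈ S ↔ Sum.inr true ∈ S), ?_, ?_⟩
    · intro Y hY
      obtain ⟨u, hu, hne⟩ := (splits_image_inl_union_iff S Y false).mp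
        (hS _ (Finset.mem_union_right _ (Finset.mem_image_of_mem _ hY)))
      exact ⟨u, Finset.mem_inter.mpr
        ⟨Finset.mem_filter.mpr ⟨Finset.mem_univ u, by tauto⟩, hu⟩⟩
    · intro i
      by_cases hi : t i < p
      · rw [card_inter_le_iff_forall_powersetCard]
        intro X hX
        obtain ⟨u, hu, hne⟩ := (splits_image_inl_union_iff S X true).mp
          (hS _ (Finset.mem_union_left _ (Finset.mem_union_right _
            (Finset.mem_biUnion.mpr ⟨i, Finset.mem_univ i, by
              rw [if_pos hi]
              exact Finset.mem_image_of_mem _ hX⟩))))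
        exact ⟨u, hu, fun h => hne (Finset.mem_filter.mp h).2⟩
      · calc _ ≤ (blocks i).card := Finset.card_le_card Finset.inter_subset_right
          _ ≤ t i := by rw [hsize i]; exact not_lt.mp hi
  · rintro ⟨H, hH, hcard⟩
    refine ⟨H.image Sum.inl ∪ {Sum.inr true}, fun T hT => ?_⟩
    rcases Finset.mem_union.mp hT with hT | hT
    · rcases Finset.mem_union.mp hT with hT | hT
      · rw [Finset.mem_singleton.mp hT, splits_pair_iff]
        simp
      · obtain ⟨i, -, hT⟩ := Finset.mem_biUnion.mp hT
        split_ifs at hT with hi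
        · obtain ⟨X, hX, rfl⟩ := Finset.mem_image.mp hT
          obtain ⟨u, hu, huH⟩ :=
            (card_inter_le_iff_forall_powersetCard H (blocks i) (t i)).mp (hcard i) X hX
          exact (splits_image_inl_union_iff _ X true).mpr ⟨u, hu, by simpa using huH⟩
        · simp at hT
    · obtain ⟨Y, hY, rfl⟩ := Finset.mem_image.mp hT
      obtain ⟨u, hu⟩ := hH Y hY
      obtain ⟨huH, huY⟩ := Finset.mem_inter.mp hu
      exact (splits_image_inl_union_iff _ Y false).mpr ⟨u, huY, by simpa using huH⟩
end

section
/- Let φ be a CNF formula over a variable set V with |V| = n in which every clause contains at most k ≥ 1 literals, and let p ≥ 3 be an odd integer dividing n. Set p' = p + 2·⌈log₂ p⌉ and n' = p'·n/p. Then there exists a finite set U with |U| = n' and a finite family F of subsets of U, each of size at most p'·k, such that the number of satisfying assignments of φ equals the number of hitting sets of F of cardinality exactly ⌈p'/2⌉·(n/p). -/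
/-- An assignment A ⊆ V (the set of true variables) satisfies a CNF formula φ
(a finite set of clauses, each a finite set of literals (v, b)) if every clause
contains a literal made true by A. -/
def SatisfiesCNF {V : Type*} (A : Finset V) (φ : Finset (Finset (V × Bool))) : Prop :=
  ∀ C ∈ φ, ∃ l ∈ C, (l.2 = true ∧ l.1 ∈ A) ∨ (l.2 = false ∧ l.1 ∉ A)

/-- The trace of `H` on the block with index `i`, where `e` partitions `U` into blocks indexed
by `ι`, each identified with `β`. -/
def blockTrace {U ι β : Type*} [Fintype β] [DecidableEq U] (e : U ≃ ι × β) (H : Finset U)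
    (i : ι) : Finset β :=
  {x | e.symm (i, x) ∈ H}

/-- The union of the blocks with index in `T`, with the elements of `H` removed. -/
def blocksDiff {U ι β : Type*} [Fintype U] [DecidableEq U] [DecidableEq ι] (e : U ≃ ι × β)
    (T : Finset ι) (H : Finset U) : Finset U :=
  {u | (e u).1 ∈ T ∧ u ∉ H}

theorem not_nonempty_inter_blocksDiff {U ι β : Type*} [Fintype U] [DecidableEq U]
    [DecidableEq ι] (e : U ≃ ι × β) (T : Finset ι) (H : Finset U) :
    ¬ (H ∩ blocksDiff e T H).Nonempty := by
  rintro ⟨u, hu⟩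
  simp only [blocksDiff, Finset.mem_inter, Finset.mem_filter] at hu
  exact hu.2.2.2 hu.1

section Blocks

variable {U ι β : Type*} [Fintype β] [DecidableEq U] (e : U ≃ ι × β)

theorem mem_blockTrace {H : Finset U} {i : ι} {x : β} :
    x ∈ blockTrace e H i ↔ e.symm (i, x) ∈ H := by
  simp [blockTrace]

theorem mem_iff_mem_blockTrace {H : Finset U} {u : U} :
    u ∈ H ↔ (e u).2 ∈ blockTrace e H (e u).1 := by
  simp [mem_blockTrace]

theorem blockTrace_injective : Function.Injective (blockTrace e) := by
  intro H K h
  ext u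
  rw [mem_iff_mem_blockTrace e, mem_iff_mem_blockTrace e, h]

theorem exists_blockTrace_eq [Fintype U] [DecidableEq β] (t : ι → Finset β) :
    ∃ H : Finset U, blockTrace e H = t := by
  refine ⟨Finset.univ.filter fun u => (e u).2 ∈ t (e u).1, ?_⟩
  ext i x
  simp [mem_blockTrace]

theorem card_eq_sum_card_blockTrace [Fintype ι] (H : Finset U) :
    H.card = ∑ i, (blockTrace e H i).card := by
  rw [← Finset.card_sigma]
  refine Finset.card_bij' (fun u _ => ⟨(e u).1, (e u).2⟩) (fun s _ => e.symm (s.1, s.2))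
    ?_ ?_ ?_ ?_ <;> simp [mem_blockTrace]

variable [Fintype U] [DecidableEq ι]

theorem card_blocksDiff_le (T : Finset ι) (H : Finset U) :
    (blocksDiff e T H).card ≤ Fintype.card β * T.card := by
  rw [mul_comm, ← Finset.card_univ (α := β), ← Finset.card_product]
  refine Finset.card_le_card_of_injOn e (fun u hu => ?_) e.injective.injOn
  have hT : (e u).1 ∈ T := by simp_all [blocksDiff]
  simp [hT]

theorem nonempty_inter_blocksDiff {T : Finset ι} {H K : Finset U} {i : ι} (hi : i ∈ T)
    (hcard : (blockTrace e H i).card ≤ (blockTrace e K i).card)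
    (hne : blockTrace e K i ≠ blockTrace e H i) :
    (K ∩ blocksDiff e T H).Nonempty := by
  have hsub : ¬ blockTrace e K i ⊆ blockTrace e H i := fun h =>
    hne (Finset.eq_of_subset_of_card_le h hcard)
  obtain ⟨x, hxK, hxH⟩ := Finset.not_subset.1 hsub
  rw [mem_blockTrace] at hxK hxH
  exact ⟨e.symm (i, x), by simp [blocksDiff, hi, hxK, hxH]⟩

end Blocks

theorem SatisfiesCNF.exists_blockTrace_ne {V ι α : Type*} [Fintype α] [DecidableEq V]
    (v : V ≃ ι × α) {φ : Finset (Finset (V × Bool))} {A B : Finset V} {C : Finset (V × Bool)}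
    (hA : SatisfiesCNF A φ) (hC : C ∈ φ)
    (hB : ¬ ∃ l ∈ C, (l.2 = true ∧ l.1 ∈ B) ∨ (l.2 = false ∧ l.1 ∉ B)) :
    ∃ l ∈ C, blockTrace v A (v l.1).1 ≠ blockTrace v B (v l.1).1 := by
  obtain ⟨l, hl, h⟩ := hA C hC
  refine ⟨l, hl, fun heq => hB ⟨l, hl, ?_⟩⟩
  rwa [mem_iff_mem_blockTrace v, ← heq, ← mem_iff_mem_blockTrace v]

/-- If every set of `q` elements of a block meets `H`, then `H` has at least `q` elements there,
as blocks have `2 * q - 1` elements. -/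
theorem le_card_blockTrace {U ι β : Type*} [Fintype β] [DecidableEq U] [DecidableEq β]
    (e : U ≃ ι × β) {q : ℕ} (hβ : Fintype.card β + 1 = 2 * q) {H : Finset U} {i : ι}
    (hH : ∀ X : Finset β, X.card = q →
      (H ∩ X.map ⟨fun x => e.symm (i, x), fun x y h => by simpa using h⟩).Nonempty) :
    q ≤ (blockTrace e H i).card := by
  by_contra! hlt
  have hle : q ≤ (blockTrace e H i)ᶜ.card := by
    rw [Finset.card_compl]
    omega
  obtain ⟨X, hX, hXq⟩ := Finset.exists_subset_card_eq hle
  obtain ⟨u, hu⟩ := hH X hXq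
  rw [Finset.mem_inter, Finset.mem_map] at hu
  obtain ⟨huH, x, hx, rfl⟩ := hu
  have := hX hx
  rw [Finset.mem_compl, mem_blockTrace] at this
  exact this huH

theorem exists_family_card_hittingSets_eq {V U ι α β : Type*} [Fintype U] [DecidableEq U]
    [Fintype ι] [Fintype α] [Fintype β] (v : V ≃ ι × α) (e : U ≃ ι × β) {q k : ℕ}
    (hβ : Fintype.card β + 1 = 2 * q)
    (hq : 2 ^ Fintype.card α ≤ (Fintype.card β).choose q) (hk : 1 ≤ k)
    (φ : Finset (Finset (V × Bool))) (hwidth : ∀ C ∈ φ, C.card ≤ k) :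
    ∃ F : Finset (Finset U), (∀ S ∈ F, S.card ≤ Fintype.card β * k) ∧
      Nat.card {A : Finset V // SatisfiesCNF A φ}
        = Nat.card {H : Finset U //
            (∀ S ∈ F, (H ∩ S).Nonempty) ∧ H.card = q * Fintype.card ι} := by
  classical
  have : Fintype V := Fintype.ofEquiv _ v.symm
  obtain ⟨ψ⟩ : Nonempty (Finset α ↪ Finset.powersetCard q (Finset.univ : Finset β)) := by
    apply Function.Embedding.nonempty_of_card_le
    simpa using hq
  have hψ (s : Finset α) : (ψ s : Finset β).card = q := (Finset.mem_powersetCard.1 (ψ s).2).2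
  choose Φ hΦ using fun A : Finset V =>
    exists_blockTrace_eq e fun i => (ψ (blockTrace v A i) : Finset β)
  have hΦcard (A : Finset V) (i : ι) : (blockTrace e (Φ A) i).card = q := by rw [hΦ, hψ]
  have hΦne {A B : Finset V} {i : ι} (h : blockTrace v A i ≠ blockTrace v B i) :
      blockTrace e (Φ A) i ≠ blockTrace e (Φ B) i := by
    rw [hΦ, hΦ]
    exact fun h' => h (ψ.injective (Subtype.ext h'))
  have hΦinj : Function.Injective Φ := by
    intro A B h
    apply blockTrace_injective v
    funext i
    by_contra hne
    exact hΦne hne (by rw [h])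
  let F : Finset (Finset U) :=
    {S | S.card ≤ Fintype.card β * k ∧ ∀ A, SatisfiesCNF A φ → (Φ A ∩ S).Nonempty}
  have hF {S : Finset U} : S ∈ F ↔
      S.card ≤ Fintype.card β * k ∧ ∀ A, SatisfiesCNF A φ → (Φ A ∩ S).Nonempty := by
    simp [F]
  refine ⟨F, fun S hS => (hF.1 hS).1, ?_⟩
  refine Nat.card_eq_of_bijective
    (fun A => ⟨Φ A.1, fun S hS => (hF.1 hS).2 A.1 A.2, ?_⟩) ⟨?_, ?_⟩
  · simp [card_eq_sum_card_blockTrace e, hΦcard, mul_comm]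
  · intro A B h
    exact Subtype.ext (hΦinj (congrArg Subtype.val h))
  rintro ⟨H, hH, hHcard⟩
  have hge (i : ι) : q ≤ (blockTrace e H i).card := by
    refine le_card_blockTrace e hβ fun X hX => hH _ (hF.2 ⟨?_, fun A _ => ?_⟩)
    · rw [Finset.card_map]
      exact X.card_le_univ.trans (Nat.le_mul_of_pos_right _ hk)
    · have hpos : 0 < (blockTrace e (Φ A) i ∩ X).card := by
        have h1 := Finset.card_union_add_card_inter (blockTrace e (Φ A) i) X
        have h2 := (blockTrace e (Φ A) i ∪ X).card_le_univ
        rw [hΦcard, hX] at h1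
        omega
      obtain ⟨x, hx⟩ := Finset.card_pos.1 hpos
      rw [Finset.mem_inter, mem_blockTrace] at hx
      exact ⟨e.symm (i, x), Finset.mem_inter.2 ⟨hx.1, Finset.mem_map.2 ⟨x, hx.2, rfl⟩⟩⟩
  have hHq (i : ι) : (blockTrace e H i).card = q := by
    have hsum : ∑ _i : ι, q = ∑ i, (blockTrace e H i).card := by
      rw [← card_eq_sum_card_blockTrace e, hHcard]
      simp [mul_comm]
    exact ((Finset.sum_eq_sum_iff_of_le fun i _ => hge i).1 hsum i (Finset.mem_univ i)).symm
  have hmiss {T : Finset ι} (hT : T.card ≤ k) :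
      ∃ A, SatisfiesCNF A φ ∧ ∀ i ∈ T, blockTrace e (Φ A) i = blockTrace e H i := by
    by_contra! hcon
    refine not_nonempty_inter_blocksDiff e T H (hH _ (hF.2 ⟨?_, fun A hA => ?_⟩))
    · exact (card_blocksDiff_le e T H).trans (Nat.mul_le_mul_left _ hT)
    · obtain ⟨i, hi, hne⟩ := hcon A hA
      exact nonempty_inter_blocksDiff e hi (by rw [hHq, hΦcard]) hne
  have hrange (i : ι) : ∃ s, (ψ s : Finset β) = blockTrace e H i := by
    obtain ⟨A, -, hA⟩ := hmiss (T := {i}) (by simpa using hk)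
    exact ⟨blockTrace v A i, by rw [← hA i (by simp), hΦ]⟩
  choose s hs using hrange
  obtain ⟨B, hB⟩ := exists_blockTrace_eq v s
  have hBH : Φ B = H := by
    apply blockTrace_injective e
    rw [hΦ, hB]
    exact funext hs
  refine ⟨⟨B, fun C hC => ?_⟩, Subtype.ext hBH⟩
  by_contra hunsat
  obtain ⟨A, hA, hAH⟩ := hmiss (T := C.image fun l => (v l.1).1)
    (Finset.card_image_le.trans (hwidth C hC))
  obtain ⟨l, hl, hne⟩ := hA.exists_blockTrace_ne v hC hunsat
  refine hΦne hne ?_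
  rw [hBH]
  exact hAH _ (Finset.mem_image_of_mem _ hl)

theorem two_pow_le_succ_mul_choose_middle (m : ℕ) : 2 ^ m ≤ (m + 1) * m.choose (m / 2) := by
  rw [← Nat.sum_range_choose]
  refine (Finset.sum_le_card_nsmul _ _ _ fun i _ => Nat.choose_le_middle i m).trans ?_
  simp

theorem two_pow_le_choose_add_two_mul_clog {p : ℕ} (hp : 3 ≤ p) :
    2 ^ p ≤ (p + 2 * Nat.clog 2 p).choose ((p + 2 * Nat.clog 2 p) / 2) := by
  have hmid := two_pow_le_succ_mul_choose_middle (p + 2 * Nat.clog 2 p)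
  have hpl : p ≤ 2 ^ Nat.clog 2 p := Nat.le_pow_clog (by norm_num) p
  have hl : Nat.clog 2 p < 2 ^ Nat.clog 2 p := Nat.lt_two_pow_self
  have hsq : p + 2 * Nat.clog 2 p + 1 ≤ 2 ^ (2 * Nat.clog 2 p) := by
    rw [two_mul (Nat.clog 2 p), pow_add]
    nlinarith
  rw [pow_add] at hmid
  refine Nat.le_of_mul_le_mul_right (c := 2 ^ (2 * Nat.clog 2 p)) ?_ (by positivity)
  calc _ ≤ _ := hmid
    _ ≤ _ := Nat.mul_le_mul_right _ hsq
    _ = _ := mul_comm _ _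

/-- For a k-CNF formula φ on n variables and an odd p ≥ 3 dividing n,
with p' = p + 2⌈log₂ p⌉ and n' = p'·(n/p), there is a family F of subsets of a
universe of size n', each set of size at most p'·k, such that the number of
satisfying assignments of φ equals the number of hitting sets of F of
cardinality exactly ⌈p'/2⌉·(n/p). -/
theorem stmt_13 {V : Type*} [Fintype V] (n k p : ℕ)
    (φ : Finset (Finset (V × Bool)))
    (hn : Fintype.card V = n) (hk : 1 ≤ k) (hwidth : ∀ C ∈ φ, C.card ≤ k)
    (hp3 : 3 ≤ p) (hodd : Odd p) (hdvd : p ∣ n) :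
    ∃ F : Finset (Finset (Fin ((p + 2 * Nat.clog 2 p) * (n / p)))),
      (∀ S ∈ F, S.card ≤ (p + 2 * Nat.clog 2 p) * k) ∧
      Nat.card {A : Finset V // SatisfiesCNF A φ}
        = Nat.card {H : Finset (Fin ((p + 2 * Nat.clog 2 p) * (n / p))) //
            (∀ S ∈ F, (H ∩ S).Nonempty) ∧
            H.card = ((p + 2 * Nat.clog 2 p + 1) / 2) * (n / p)} := by
  obtain ⟨m, rfl⟩ := hdvd
  have hm : p * m / p = m := Nat.mul_div_cancel_left m (by omega)
  rw [hm]
  set p' := p + 2 * Nat.clog 2 p with hp'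
  obtain ⟨r, hr⟩ : Odd p' := hodd.add_even (even_two_mul _)
  have hchoose : 2 ^ p ≤ p'.choose ((p' + 1) / 2) := by
    have h := two_pow_le_choose_add_two_mul_clog hp3
    rwa [← hp', ← Nat.choose_symm (Nat.div_le_self _ _),
      show p' - p' / 2 = (p' + 1) / 2 by omega] at h
  have v : V ≃ Fin m × Fin p := Fintype.equivOfCardEq (by simp [hn, mul_comm])
  have e : Fin (p' * m) ≃ Fin m × Fin p' := Fintype.equivOfCardEq (by simp [mul_comm])
  simpa only [Fintype.card_fin] using exists_family_card_hittingSets_eq v e (q := (p' + 1) / 2)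
    (by rw [Fintype.card_fin]; omega) (by simpa using hchoose) hk φ hwidth
end

section
/- Let F be a finite family of subsets of a finite set U. Define the simple graph G' whose vertices are: one vertex for each S ∈ F, one vertex for each e ∈ U, and two additional vertices s and u; its edges are: {S, e} whenever e ∈ S, {s, S} for every S ∈ F, and {s, u}. Then for every natural number i, the number of vertex subsets X of G' with U ∪ {u} ⊆ X, |X| = |U| + i + 2, and the induced subgraph G'[X] connected, equals the number of subfamilies C ⊆ F with |C| = i and ⋃_{S ∈ C} S = U. -/
/-- Vertices of the graph G': one vertex per set S ∈ F, one per element e ∈ U,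
plus two extra vertices s = Sum.inr true and u = Sum.inr false. -/
abbrev SteinerVert (U : Type*) (F : Finset (Finset U)) : Type _ :=
  ({S : Finset U // S ∈ F} ⊕ U) ⊕ Bool

/-- The edge relation of G': {S, e} whenever e ∈ S, {s, S} for every S ∈ F,
and {s, u}. -/
def steinerRel {U : Type*} (F : Finset (Finset U)) :
    SteinerVert U F → SteinerVert U F → Prop
  | Sum.inl (Sum.inl S), Sum.inl (Sum.inr e) => e ∈ S.1
  | Sum.inr true, Sum.inl (Sum.inl _) => True
  | Sum.inr true, Sum.inr false => True
  | _, _ => False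

theorem SimpleGraph.exists_adj_mem_of_induce_connected {V : Type*} {G : SimpleGraph V}
    {X : Finset V} (h : (G.induce (↑X : Set V)).Connected) (hX : 1 < X.card) {v : V}
    (hv : v ∈ X) : ∃ w ∈ X, G.Adj v w := by
  have : Nontrivial (↑X : Set V) :=
    Set.nontrivial_coe_sort.2 (Finset.one_lt_card_iff_nontrivial.1 hX)
  obtain ⟨⟨w, hw⟩, hvw⟩ := h.preconnected.exists_adj_of_nontrivial ⟨v, hv⟩
  exact ⟨w, hw, hvw⟩

/-- The vertex set made of the sets in `A`, all elements, and both extra vertices. -/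
def steinerSet {U : Type*} [Fintype U] {F : Finset (Finset U)}
    (A : Finset {S : Finset U // S ∈ F}) : Finset (SteinerVert U F) :=
  (A.disjSum Finset.univ).disjSum Finset.univ

theorem card_steinerSet {U : Type*} [Fintype U] {F : Finset (Finset U)}
    (A : Finset {S : Finset U // S ∈ F}) :
    (steinerSet A).card = Fintype.card U + A.card + 2 := by
  simp [steinerSet, Finset.card_disjSum, add_comm]

theorem steinerSet_injective {U : Type*} [Fintype U] {F : Finset (Finset U)} :
    Function.Injective (steinerSet (U := U) (F := F)) := fun A B h => by
  simpa [steinerSet] using h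

theorem adj_inl_inr_iff {U : Type*} {F : Finset (Finset U)} {e : U} {w : SteinerVert U F} :
    (SimpleGraph.fromRel (steinerRel F)).Adj (Sum.inl (Sum.inr e)) w ↔
      ∃ S : {S : Finset U // S ∈ F}, e ∈ S.1 ∧ w = Sum.inl (Sum.inl S) := by
  rcases w with (S | e') | (_ | _) <;> simp [steinerRel]

theorem adj_inr_false_iff {U : Type*} {F : Finset (Finset U)} {w : SteinerVert U F} :
    (SimpleGraph.fromRel (steinerRel F)).Adj (Sum.inr false) w ↔ w = Sum.inr true := by
  rcases w with (S | e') | (_ | _) <;> simp [steinerRel]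

theorem adj_inr_true_inl_inl {U : Type*} {F : Finset (Finset U)}
    (S : {S : Finset U // S ∈ F}) :
    (SimpleGraph.fromRel (steinerRel F)).Adj (Sum.inr true) (Sum.inl (Sum.inl S)) := by
  simp [steinerRel]

theorem induce_steinerSet_connected_iff {U : Type*} [Fintype U] {F : Finset (Finset U)}
    (A : Finset {S : Finset U // S ∈ F}) :
    ((SimpleGraph.fromRel (steinerRel F)).induce
      (↑(steinerSet A) : Set (SteinerVert U F))).Connected ↔ ∀ e : U, ∃ S ∈ A, e ∈ S.1 := by
  constructor
  · intro h e
    obtain ⟨w, hw, hadj⟩ := SimpleGraph.exists_adj_mem_of_induce_connected h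
      (by rw [card_steinerSet]; omega) (v := Sum.inl (Sum.inr e)) (by simp [steinerSet])
    obtain ⟨S, heS, rfl⟩ := adj_inl_inr_iff.1 hadj
    exact ⟨S, by simpa [steinerSet] using hw, heS⟩
  · intro h
    rw [SimpleGraph.connected_iff_exists_forall_reachable]
    have hs : Sum.inr true ∈ (↑(steinerSet A) : Set (SteinerVert U F)) := by simp [steinerSet]
    have hset (S : {S : Finset U // S ∈ F})
        (hS : Sum.inl (Sum.inl S) ∈ (↑(steinerSet A) : Set (SteinerVert U F))) :
        ((SimpleGraph.fromRel (steinerRel F)).induce _).Reachable ⟨_, hs⟩ ⟨_, hS⟩ :=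
      SimpleGraph.Adj.reachable (SimpleGraph.induce_adj.2 (adj_inr_true_inl_inl S))
    refine ⟨⟨_, hs⟩, ?_⟩
    rintro ⟨(S | e) | (_ | _), hw⟩
    · exact hset S hw
    · obtain ⟨S, hSA, heS⟩ := h e
      have hS : Sum.inl (Sum.inl S) ∈ (↑(steinerSet A) : Set (SteinerVert U F)) := by
        simpa [steinerSet] using hSA
      refine (hset S hS).trans (SimpleGraph.Adj.reachable (SimpleGraph.Adj.symm ?_))
      exact SimpleGraph.induce_adj.2 (adj_inl_inr_iff.2 ⟨S, heS, rfl⟩)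
    · refine SimpleGraph.Adj.reachable (SimpleGraph.Adj.symm ?_)
      exact SimpleGraph.induce_adj.2 (adj_inr_false_iff.2 rfl)
    · rfl

theorem exists_eq_steinerSet {U : Type*} [Fintype U] {F : Finset (Finset U)}
    {X : Finset (SteinerVert U F)} (hU : ∀ e : U, Sum.inl (Sum.inr e) ∈ X)
    (hu : Sum.inr false ∈ X) (hs : Sum.inr true ∈ X) : ∃ A, X = steinerSet A := by
  refine ⟨X.toLeft.toLeft, ?_⟩
  ext ((S | e) | (_ | _)) <;> simp [steinerSet, hU, hu, hs]

/-- In the graph G' obtained from the incidence graph of (F, U) by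
adding a vertex s universal to F with a pendant vertex u, the number of vertex
subsets X containing U ∪ {u} with |X| = |U| + i + 2 inducing a connected subgraph
equals the number of set covers of (F, U) of size exactly i. -/
theorem stmt_15 {U : Type*} [Fintype U] (F : Finset (Finset U)) (i : ℕ) :
    Nat.card {X : Finset (SteinerVert U F) //
        (∀ e : U, Sum.inl (Sum.inr e) ∈ X) ∧
        (Sum.inr false : SteinerVert U F) ∈ X ∧
        X.card = Fintype.card U + i + 2 ∧
        ((SimpleGraph.fromRel (steinerRel F)).induce
            (↑X : Set (SteinerVert U F))).Connected}
      = Nat.card {C : Finset (Finset U) // C ⊆ F ∧ C.card = i ∧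
          ∀ u : U, ∃ S ∈ C, u ∈ S} := by
  classical
  symm
  let f (C : Finset (Finset U)) : Finset (SteinerVert U F) := steinerSet (C.subtype (· ∈ F))
  have hcard {C : Finset (Finset U)} (hC : C ⊆ F) : (C.subtype (· ∈ F)).card = C.card := by
    rw [Finset.card_subtype, Finset.filter_true_of_mem hC]
  refine Nat.card_congr (Equiv.ofBijective (fun C => ⟨f C.1, ?_, ?_, ?_, ?_⟩) ⟨?_, ?_⟩)
  · simp [f, steinerSet]
  · simp [f, steinerSet]
  · rw [card_steinerSet, hcard C.2.1, C.2.2.1]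
  · refine (induce_steinerSet_connected_iff _).2 fun e => ?_
    obtain ⟨S, hS, heS⟩ := C.2.2.2 e
    exact ⟨⟨S, C.2.1 hS⟩, Finset.mem_subtype.2 hS, heS⟩
  · rintro ⟨C, hC, _⟩ ⟨D, hD, _⟩ h
    have hCD := steinerSet_injective (congrArg Subtype.val h)
    rw [Subtype.mk.injEq, ← Finset.subtype_map_of_mem hC, ← Finset.subtype_map_of_mem hD, hCD]
  · rintro ⟨X, hU, hu, hX, hconn⟩
    obtain ⟨w, hw, hadj⟩ :=
      SimpleGraph.exists_adj_mem_of_induce_connected hconn (by omega) hu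
    rw [adj_inr_false_iff.1 hadj] at hw
    obtain ⟨A, rfl⟩ := exists_eq_steinerSet hU hu hw
    have hA : (A.map (Function.Embedding.subtype (· ∈ F))).subtype (· ∈ F) = A := by
      ext ⟨S, hS⟩
      simp [hS]
    refine ⟨⟨A.map (Function.Embedding.subtype (· ∈ F)), ?_, ?_, ?_⟩, ?_⟩
    · exact Finset.map_subtype_subset A
    · rw [Finset.card_map]
      rw [card_steinerSet] at hX
      omega
    · intro e
      obtain ⟨S, hS, heS⟩ := (induce_steinerSet_connected_iff A).1 hconn e
      exact ⟨S.1, Finset.mem_map_of_mem _ hS, heS⟩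
    · exact Subtype.ext (congrArg steinerSet hA)
end

section
/- Let F be a finite family of subsets of a finite set U and let t be a natural number. Define the simple graph G whose vertices are: one vertex for each S ∈ F, one vertex for each e ∈ U, a vertex s, a pendant vertex e' for each e ∈ U, and a pendant vertex s'; its edges are: {S, e} whenever e ∈ S, {s, S} for every S ∈ F, {e, e'} for each e ∈ U, and {s, s'}. Then F has a subfamily of size at most t whose union is U if and only if G has a connected vertex cover of size at most t + |U| + 1. -/
/-- Vertices of the graph G: one vertex per set S ∈ F (Sum.inl (Sum.inl (Sum.inl S))),
one per element e ∈ U (Sum.inl (Sum.inl (Sum.inr e))), one pendant vertex e' per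
element e ∈ U (Sum.inl (Sum.inr e)), plus s = Sum.inr true and its pendant
s' = Sum.inr false. -/
abbrev CVCVert (U : Type*) (F : Finset (Finset U)) : Type _ :=
  (({S : Finset U // S ∈ F} ⊕ U) ⊕ U) ⊕ Bool

/-- The edge relation of G: {S, e} whenever e ∈ S, {s, S} for every S ∈ F,
{e, e'} for every e ∈ U, and {s, s'}. -/
def cvcRel {U : Type*} (F : Finset (Finset U)) :
    CVCVert U F → CVCVert U F → Prop
  | Sum.inl (Sum.inl (Sum.inl S)), Sum.inl (Sum.inl (Sum.inr e)) => e ∈ S.1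
  | Sum.inr true, Sum.inl (Sum.inl (Sum.inl _)) => True
  | Sum.inl (Sum.inl (Sum.inr e)), Sum.inl (Sum.inr e') => e = e'
  | Sum.inr true, Sum.inr false => True
  | _, _ => False

/-- In a connected induced subgraph, some edge leaves any set of vertices that is met by the
subgraph and does not contain it. -/
theorem SimpleGraph.exists_adj_mem_notMem_of_connected_induce {V : Type*} {G : SimpleGraph V}
    {X : Set V} (h : (G.induce X).Connected) (A : Set V) {a b : V} (ha : a ∈ X) (hb : b ∈ X)
    (haA : a ∈ A) (hbA : b ∉ A) : ∃ x ∈ X, ∃ y ∈ X, G.Adj x y ∧ x ∈ A ∧ y ∉ A := by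
  obtain ⟨p⟩ := h.preconnected ⟨a, ha⟩ ⟨b, hb⟩
  obtain ⟨d, -, hd₁, hd₂⟩ := p.exists_boundary_dart (Subtype.val ⁻¹' A) haA hbA
  exact ⟨d.fst, d.fst.2, d.snd, d.snd.2, d.adj, hd₁, hd₂⟩

open SimpleGraph in
/-- A set cover together with all elements and `s` is a connected vertex cover. -/
theorem exists_connected_vertexCover_of_setCover {U : Type*} [Fintype U]
    (F C : Finset (Finset U)) (hCF : C ⊆ F) (hC : ∀ u : U, ∃ S ∈ C, u ∈ S) :
    ∃ X : Finset (CVCVert U F),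
      (∀ a b : CVCVert U F, (fromRel (cvcRel F)).Adj a b → a ∈ X ∨ b ∈ X) ∧
      ((fromRel (cvcRel F)).induce (↑X : Set (CVCVert U F))).Connected ∧
      X.card = C.card + Fintype.card U + 1 := by
  classical
  let X : Finset (CVCVert U F) :=
    (((C.subtype (· ∈ F)).disjSum Finset.univ).disjSum ∅).disjSum {true}
  refine ⟨X, ?_, ?_, ?_⟩
  · rintro (((a | a) | a) | _ | _) (((b | b) | b) | _ | _) <;> simp [X, cvcRel]
  · have hs : Sum.inr true ∈ X := by simp [X]
    have reach_set : ∀ (S : {S // S ∈ F}) (hS : Sum.inl (Sum.inl (Sum.inl S)) ∈ X),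
        ((fromRel (cvcRel F)).induce (↑X : Set (CVCVert U F))).Reachable
          ⟨Sum.inr true, hs⟩ ⟨_, hS⟩ := fun S hS => Adj.reachable (by simp [cvcRel])
    rw [connected_iff_exists_forall_reachable]
    refine ⟨⟨Sum.inr true, hs⟩, ?_⟩
    rintro ⟨((S | e) | e) | _ | _, hx⟩
    · exact reach_set S hx
    · obtain ⟨S, hSC, heS⟩ := hC e
      have hS : Sum.inl (Sum.inl (Sum.inl ⟨S, hCF hSC⟩)) ∈ X := by simp [X, hSC]
      exact (reach_set ⟨S, hCF hSC⟩ hS).trans (Adj.reachable (by simp [cvcRel, heS]))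
    · simp [X] at hx
    · simp [X] at hx
    · rfl
  · have hcard : (C.subtype (· ∈ F)).card = C.card := by
      rw [Finset.card_subtype, Finset.filter_true_of_mem hCF]
    simp [X, hcard]

open SimpleGraph in
/-- The sets contained in a connected vertex cover form a set cover. -/
theorem exists_setCover_of_connected_vertexCover {U : Type*} [Fintype U]
    (F : Finset (Finset U)) (X : Finset (CVCVert U F))
    (hX : ∀ a b : CVCVert U F, (fromRel (cvcRel F)).Adj a b → a ∈ X ∨ b ∈ X)
    (hconn : ((fromRel (cvcRel F)).induce (↑X : Set (CVCVert U F))).Connected) :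
    ∃ C ⊆ F, C.card + Fintype.card U + 1 ≤ X.card ∧ ∀ u : U, ∃ S ∈ C, u ∈ S := by
  classical
  have hU (e : U) : Sum.inl (Sum.inl (Sum.inr e)) ∈ X ∨ Sum.inl (Sum.inr e) ∈ X :=
    hX _ _ (by simp [cvcRel])
  have hs : Sum.inr true ∈ X ∨ Sum.inr false ∈ X := hX _ _ (by simp [cvcRel])
  refine ⟨X.toLeft.toLeft.toLeft.map (Function.Embedding.subtype _), ?_, ?_, fun e => ?_⟩
  · intro S hS
    obtain ⟨T, -, rfl⟩ := Finset.mem_map.1 hS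
    exact T.2
  · have h₁ := X.card_toLeft_add_card_toRight
    have h₂ := X.toLeft.card_toLeft_add_card_toRight
    have h₃ := X.toLeft.toLeft.card_toLeft_add_card_toRight
    have h_elems : Fintype.card U ≤ X.toLeft.toLeft.toRight.card + X.toLeft.toRight.card := by
      refine le_trans ?_ (Finset.card_union_le _ _)
      rw [← Finset.card_univ]
      exact Finset.card_le_card fun e _ => by simpa using hU e
    have h_s : 0 < X.toRight.card := by
      rw [Finset.card_pos]
      rcases hs with h | h
      · exact ⟨true, by simpa using h⟩
      · exact ⟨false, by simpa using h⟩
    rw [Finset.card_map]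
    omega
  · obtain ⟨a, haX, haA⟩ : ∃ a ∈ X, a ∈ ({Sum.inl (Sum.inl (Sum.inr e)),
        Sum.inl (Sum.inr e)} : Set (CVCVert U F)) := by
      rcases hU e with h | h <;> exact ⟨_, h, by simp⟩
    obtain ⟨b, hbX, hbA⟩ : ∃ b ∈ X, b ∉ ({Sum.inl (Sum.inl (Sum.inr e)),
        Sum.inl (Sum.inr e)} : Set (CVCVert U F)) := by
      rcases hs with h | h <;> exact ⟨_, h, by simp⟩
    obtain ⟨x, hx, y, hy, hxy, hxA, hyA⟩ :=
      exists_adj_mem_notMem_of_connected_induce hconn _ haX hbX haA hbA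
    rcases hxA with rfl | rfl <;> rcases y with ((S | f) | f) | _ | _ <;>
      simp [cvcRel] at hxy hyA
    · exact ⟨S, by simpa using hy, hxy⟩
    · exact absurd hxy.symm hyA
    · exact absurd hxy hyA

/-- F has a set cover of size at most t iff the graph G has a
connected vertex cover of size at most t + |U| + 1. -/
theorem stmt_16 {U : Type*} [Fintype U] (F : Finset (Finset U)) (t : ℕ) :
    (∃ C ⊆ F, C.card ≤ t ∧ ∀ u : U, ∃ S ∈ C, u ∈ S) ↔
      (∃ X : Finset (CVCVert U F),
        (∀ a b : CVCVert U F, (SimpleGraph.fromRel (cvcRel F)).Adj a b → a ∈ X ∨ b ∈ X) ∧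
        ((SimpleGraph.fromRel (cvcRel F)).induce (↑X : Set (CVCVert U F))).Connected ∧
        X.card ≤ t + Fintype.card U + 1) := by
  constructor
  · rintro ⟨C, hCF, hCt, hC⟩
    obtain ⟨X, hX, hconn, hcard⟩ := exists_connected_vertexCover_of_setCover F C hCF hC
    exact ⟨X, hX, hconn, by omega⟩
  · rintro ⟨X, hX, hconn, hcard⟩
    obtain ⟨C, hCF, hCX, hC⟩ := exists_setCover_of_connected_vertexCover F X hX hconn
    exact ⟨C, hCF, by omega, hC⟩
end
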